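/- With W(i,j) the minimum matching weight on points xᵢ,...,xⱼ, the recursion W(i,j) = min( d(xᵢ,xⱼ) + W(i+1,j-1), W(i,j-2) + W(i+2,j) - W(i+2,j-2) ) holds for all i < j of opposite parity, with conventions W(i,i-1) = 0 and W(i+2,i-1) = -d(xᵢ,x_{i+1}). -/

import Mathlib

/-- `f` is a perfect matching of the index interval `{i, …, j}`. -/
def IsPM (i j : ℕ) (f : ℕ → ℕ) : Prop :=
  ∀ k ∈ Finset.Icc i j, f k ∈ Finset.Icc i j ∧ f (f k) = k ∧ f k ≠ k

/-- The weight of the matching `f` of `{i, …, j}` (each pair counted once). -/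
noncomputable def matchWeight (x : ℕ → ℝ) (g : ℝ → ℝ) (i j : ℕ) (f : ℕ → ℕ) : ℝ :=
  (∑ k ∈ Finset.Icc i j, g |x k - x (f k)|) / 2

/-- `w` is the minimum weight of a perfect matching on `{i, …, j}`. -/
def IsMinWeight (x : ℕ → ℝ) (g : ℝ → ℝ) (i j : ℕ) (w : ℝ) : Prop :=
  (∃ f, IsPM i j f ∧ w = matchWeight x g i j f) ∧
  ∀ f, IsPM i j f → w ≤ matchWeight x g i j f

theorem crossing_lt {g : ℝ → ℝ}
    (hconc : ∀ a : ℝ, 0 ≤ a → ∀ b : ℝ, 0 ≤ b → a ≠ b → ∀ l : ℝ, 0 < l → l < 1 →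
      l * g a + (1 - l) * g b < g (l * a + (1 - l) * b))
    {p q r : ℝ} (hp : 0 < p) (hq : 0 ≤ q) (hr : 0 < r) :
    g (p + q + r) + g q < g (p + q) + g (q + r) := by
  have hpr : 0 < p + r := by linarith
  have hne : q ≠ p + q + r := by linarith
  have hsum : r / (p + r) + p / (p + r) = 1 := by field_simp; ring
  have h1 := hconc q hq (p + q + r) (by linarith) hne (r / (p + r)) (by positivity)
    (by have := div_pos hp hpr; linarith)
  have h2 := hconc q hq (p + q + r) (by linarith) hne (p / (p + r)) (by positivity)
    (by have := div_pos hr hpr; linarith)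
  have e1 : r / (p + r) * q + (1 - r / (p + r)) * (p + q + r) = p + q := by field_simp; ring
  have e2 : p / (p + r) * q + (1 - p / (p + r)) * (p + q + r) = q + r := by field_simp; ring
  rw [e1] at h1
  rw [e2] at h2
  have e3 : p / (p + r) = 1 - r / (p + r) := by linarith
  rw [e3] at h2
  linarith

section Matching

variable {x : ℕ → ℝ} {g : ℝ → ℝ} {a k c : ℕ} {f f₁ f₂ : ℕ → ℕ}

theorem matchWeight_congr (h : ∀ m ∈ Finset.Icc a c, f₁ m = f₂ m) :
    matchWeight x g a c f₁ = matchWeight x g a c f₂ := by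
  unfold matchWeight
  rw [Finset.sum_congr rfl fun m hm => by rw [h m hm]]

theorem matchWeight_split (hak : a ≤ k) (hkc : k < c) :
    matchWeight x g a c f = matchWeight x g a k f + matchWeight x g (k + 1) c f := by
  have h : Finset.Icc a c = Finset.Icc a k ∪ Finset.Icc (k + 1) c := by
    ext m; simp only [Finset.mem_union, Finset.mem_Icc]; omega
  have hd : Disjoint (Finset.Icc a k) (Finset.Icc (k + 1) c) := by
    rw [Finset.disjoint_left]; intro m; simp only [Finset.mem_Icc]; omega
  unfold matchWeight
  rw [h, Finset.sum_union hd]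
  ring

theorem matchWeight_outer (hac : a < c) (ha : f a = c) (hc : f c = a) :
    matchWeight x g a c f = g |x a - x c| + matchWeight x g (a + 1) (c - 1) f := by
  have h : Finset.Icc a c = insert a (insert c (Finset.Icc (a + 1) (c - 1))) := by
    ext m; simp only [Finset.mem_insert, Finset.mem_Icc]; omega
  unfold matchWeight
  rw [h, Finset.sum_insert (by simp; omega), Finset.sum_insert (by simp; omega), ha, hc,
    abs_sub_comm (x c)]
  ring

theorem matchWeight_empty (h : c < a) : matchWeight x g a c f = 0 := by
  simp [matchWeight, Finset.Icc_eq_empty (not_le.mpr h)]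

theorem IsPM.glue (h₁ : IsPM a k f₁) (h₂ : IsPM (k + 1) c f₂) (hak : a ≤ k) (hkc : k < c) :
    IsPM a c fun m => if m ≤ k then f₁ m else f₂ m := by
  intro m hm
  simp only [Finset.mem_Icc] at hm
  by_cases hmk : m ≤ k
  · obtain ⟨h, h', h''⟩ := h₁ m (by simp; omega)
    simp only [Finset.mem_Icc] at h
    simp only [hmk, h.2, if_true, Finset.mem_Icc]
    exact ⟨by omega, h', h''⟩
  · obtain ⟨h, h', h''⟩ := h₂ m (by simp; omega)
    simp only [Finset.mem_Icc] at h
    have : ¬ f₂ m ≤ k := by omega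
    simp only [hmk, this, if_false, Finset.mem_Icc]
    exact ⟨by omega, h', h''⟩

theorem IsPM.wrap (h : IsPM (a + 1) (c - 1) f) (hac : a < c) :
    IsPM a c fun m => if m = a then c else if m = c then a else f m := by
  intro m hm
  simp only [Finset.mem_Icc] at hm
  by_cases hma : m = a
  · subst hma
    simp only [if_true, Finset.mem_Icc, hac.ne', if_false]
    exact ⟨by omega, trivial, by omega⟩
  by_cases hmc : m = c
  · subst hmc
    simp only [if_true, Finset.mem_Icc, hac.ne', if_false]
    exact ⟨by omega, trivial, by omega⟩
  · obtain ⟨h, h', h''⟩ := h m (by simp; omega)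
    simp only [Finset.mem_Icc] at h
    have h1 : f m ≠ a := by omega
    have h2 : f m ≠ c := by omega
    simp only [hma, hmc, h1, h2, if_false, Finset.mem_Icc]
    exact ⟨by omega, h', h''⟩

theorem IsPM.odd_sub (h : IsPM a c f) (hac : a ≤ c) : Odd (c - a) := by
  have hs : ∑ _m ∈ Finset.Icc a c, (1 : ZMod 2) = 0 :=
    Finset.sum_involution (fun m _ => f m) (fun _ _ => by decide)
      (fun m hm _ => (h m hm).2.2) (fun m hm => (h m hm).1) (fun m hm => (h m hm).2.1)
  rw [Finset.sum_const, nsmul_one, Nat.card_Icc, ZMod.natCast_eq_zero_iff_even] at hs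
  rw [← Nat.not_even_iff_odd]
  rcases hs with ⟨u, hu⟩
  rintro ⟨v, hv⟩
  omega

theorem IsPM.exists_lt_of_crossing (hx : StrictMono x)
    (hconc : ∀ a : ℝ, 0 ≤ a → ∀ b : ℝ, 0 ≤ b → a ≠ b → ∀ l : ℝ, 0 < l → l < 1 →
      l * g a + (1 - l) * g b < g (l * a + (1 - l) * b))
    (h : IsPM a c f) {m : ℕ} (ham : a < m) (hmk : m < f a) (hkm : f a < f m) (hmc : m ≤ c) :
    ∃ f', IsPM a c f' ∧ matchWeight x g a c f' < matchWeight x g a c f := by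
  obtain ⟨k, hk⟩ : ∃ k, f a = k := ⟨_, rfl⟩
  obtain ⟨n, hn⟩ : ∃ n, f m = n := ⟨_, rfl⟩
  obtain ⟨hA, hA', -⟩ := h a (by simp; omega)
  obtain ⟨hM, hM', -⟩ := h m (by simp; omega)
  rw [hk] at hmk hkm hA hA'
  rw [hn] at hkm hM hM'
  simp only [Finset.mem_Icc] at hA hM
  let f' : ℕ → ℕ := fun t =>
    if t = a then n else if t = n then a else if t = m then k else if t = k then m else f t
  have f'a : f' a = n := by simp [f']
  have f'n : f' n = a := by simp [f']
  have f'm : f' m = k := by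
    simp only [f', if_true]; rw [if_neg (by omega), if_neg (by omega)]
  have f'k : f' k = m := by
    simp only [f', if_true]; rw [if_neg (by omega), if_neg (by omega), if_neg (by omega)]
  have f'o : ∀ t, t ≠ a → t ≠ n → t ≠ m → t ≠ k → f' t = f t := by
    intro t h1 h2 h3 h4; simp only [f', h1, h2, h3, h4, if_false]
  refine ⟨f', ?_, ?_⟩
  · intro t ht
    by_cases h1 : t = a
    · subst h1; rw [f'a, f'n]; exact ⟨by simp; omega, rfl, by omega⟩
    by_cases h2 : t = n
    · subst h2; rw [f'n, f'a]; exact ⟨by simp; omega, rfl, by omega⟩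
    by_cases h3 : t = m
    · subst h3; rw [f'm, f'k]; exact ⟨by simp; omega, rfl, by omega⟩
    by_cases h4 : t = k
    · subst h4; rw [f'k, f'm]; exact ⟨by simp; omega, rfl, by omega⟩
    obtain ⟨hT, hT', hT''⟩ := h t ht
    rw [f'o t h1 h2 h3 h4, f'o (f t)]
    · exact ⟨hT, hT', hT''⟩
    all_goals
      intro he
      rw [he] at hT'
      omega
  · have hsub : ({a, m, k, n} : Finset ℕ) ⊆ Finset.Icc a c := by
      intro t; simp only [Finset.mem_insert, Finset.mem_singleton, Finset.mem_Icc]; omega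
    have hfour : ∀ F : ℕ → ℝ, ∑ t ∈ ({a, m, k, n} : Finset ℕ), F t = F a + F m + F k + F n := by
      intro F
      rw [Finset.sum_insert (by simp; omega), Finset.sum_insert (by simp; omega),
        Finset.sum_insert (by simp; omega), Finset.sum_singleton]
      ring
    have hrest : ∑ t ∈ Finset.Icc a c \ {a, m, k, n}, g |x t - x (f' t)| =
        ∑ t ∈ Finset.Icc a c \ {a, m, k, n}, g |x t - x (f t)| := by
      refine Finset.sum_congr rfl fun t ht => ?_
      simp only [Finset.mem_sdiff, Finset.mem_insert, Finset.mem_singleton, not_or] at ht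
      rw [f'o t ht.2.1 ht.2.2.2.2 ht.2.2.1 ht.2.2.2.1]
    unfold matchWeight
    rw [← Finset.sum_sdiff hsub, ← Finset.sum_sdiff hsub (f := fun t => g |x t - x (f t)|), hrest,
      hfour, hfour, f'a, f'm, f'k, f'n, hk, hn, hA', hM']
    have l1 := hx ham
    have l2 := hx hmk
    have l3 := hx hkm
    have hcross := crossing_lt hconc (sub_pos.mpr l1) (sub_pos.mpr l2).le (sub_pos.mpr l3)
    rw [abs_sub_comm (x k) (x m), abs_sub_comm (x n) (x a), abs_sub_comm (x k) (x a),
      abs_sub_comm (x n) (x m), abs_sub_comm (x a) (x n), abs_sub_comm (x m) (x k),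
      abs_sub_comm (x a) (x k), abs_sub_comm (x m) (x n),
      abs_of_pos (show 0 < x n - x a by linarith), abs_of_pos (show 0 < x k - x m by linarith),
      abs_of_pos (show 0 < x k - x a by linarith), abs_of_pos (show 0 < x n - x m by linarith)]
    rw [show x m - x a + (x k - x m) + (x n - x k) = x n - x a by ring,
      show x m - x a + (x k - x m) = x k - x a by ring,
      show x k - x m + (x n - x k) = x n - x m by ring] at hcross
    linarith

end Matching

section MinWeight

variable {x : ℕ → ℝ} {g : ℝ → ℝ} {W : ℕ → ℕ → ℝ}

theorem minWeight_le_add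
    (hW : ∀ i j : ℕ, 1 ≤ i → i < j → Odd (j - i) → IsMinWeight x g i j (W i j))
    (hnil : ∀ i : ℕ, 1 ≤ i → W i (i - 1) = 0) {a k c : ℕ} (ha : 1 ≤ a) (hak : a ≤ k + 1)
    (hkc : k ≤ c) (h₁ : Odd (k + 2 - a)) (h₂ : Even (c - k)) :
    W a c ≤ W a k + W (k + 1) c := by
  obtain ⟨u, hu⟩ := h₁
  obtain ⟨v, hv⟩ := h₂
  rcases eq_or_lt_of_le hak with rfl | hak
  · have := hnil (k + 1) ha
    simp only [Nat.add_sub_cancel] at this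
    rw [this, zero_add]
  rcases eq_or_lt_of_le hkc with rfl | hkc
  · have := hnil (k + 1) (by omega)
    simp only [Nat.add_sub_cancel] at this
    rw [this, add_zero]
  obtain ⟨⟨f₁, hf₁, e₁⟩, -⟩ := hW a k ha (by omega) ⟨u - 1, by omega⟩
  obtain ⟨⟨f₂, hf₂, e₂⟩, -⟩ := hW (k + 1) c (by omega) (by omega) ⟨v - 1, by omega⟩
  have h := (hW a c ha (by omega) ⟨u - 1 + v, by omega⟩).2 _
    (hf₁.glue hf₂ (by omega) hkc)
  rw [matchWeight_split (by omega) hkc] at h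
  rw [e₁, e₂]
  refine h.trans_eq (congrArg₂ (· + ·) (matchWeight_congr ?_) (matchWeight_congr ?_))
  · intro m hm
    simp only [Finset.mem_Icc] at hm
    exact if_pos hm.2
  · intro m hm
    simp only [Finset.mem_Icc] at hm
    exact if_neg (by omega)

theorem minWeight_le_outer
    (hW : ∀ i j : ℕ, 1 ≤ i → i < j → Odd (j - i) → IsMinWeight x g i j (W i j))
    (hnil : ∀ i : ℕ, 1 ≤ i → W i (i - 1) = 0) {a c : ℕ} (ha : 1 ≤ a) (hac : a < c)
    (hodd : Odd (c - a)) :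
    W a c ≤ g |x a - x c| + W (a + 1) (c - 1) := by
  have hmin := (hW a c ha hac hodd).2
  obtain ⟨u, hu⟩ := hodd
  obtain ⟨f, hf, e⟩ : ∃ f, IsPM (a + 1) (c - 1) f ∧
      W (a + 1) (c - 1) = matchWeight x g (a + 1) (c - 1) f := by
    by_cases h : c = a + 1
    · subst h
      refine ⟨id, fun m hm => ?_, ?_⟩
      · simp only [Finset.mem_Icc] at hm; omega
      · rw [matchWeight_empty (by omega)]
        exact hnil (a + 1) (by omega)
    · exact (hW (a + 1) (c - 1) (by omega) (by omega) ⟨u - 1, by omega⟩).1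
  have h := hmin _ (hf.wrap hac)
  rw [matchWeight_outer hac (by simp) (by simp [hac.ne'])] at h
  rw [e]
  refine h.trans_eq (congrArg _ (matchWeight_congr fun m hm => ?_))
  simp only [Finset.mem_Icc] at hm
  rw [if_neg (by omega), if_neg (by omega)]

theorem minWeight_outer_or_split (hx : StrictMono x)
    (hconc : ∀ a : ℝ, 0 ≤ a → ∀ b : ℝ, 0 ≤ b → a ≠ b → ∀ l : ℝ, 0 < l → l < 1 →
      l * g a + (1 - l) * g b < g (l * a + (1 - l) * b))
    (hW : ∀ i j : ℕ, 1 ≤ i → i < j → Odd (j - i) → IsMinWeight x g i j (W i j))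
    (hnil : ∀ i : ℕ, 1 ≤ i → W i (i - 1) = 0) {a c : ℕ} (ha : 1 ≤ a) (hac : a < c)
    (hodd : Odd (c - a)) :
    g |x a - x c| + W (a + 1) (c - 1) ≤ W a c ∨
      ∃ k, a < k ∧ k < c ∧ Odd (k - a) ∧ W a k + W (k + 1) c ≤ W a c := by
  obtain ⟨⟨f, hf, e⟩, hmin⟩ := hW a c ha hac hodd
  obtain ⟨u, hu⟩ := hodd
  obtain ⟨k, hk⟩ : ∃ k, f a = k := ⟨_, rfl⟩
  obtain ⟨hA, hka, hA''⟩ := hf a (by simp; omega)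
  rw [hk] at hA hka hA''
  simp only [Finset.mem_Icc] at hA
  rcases eq_or_lt_of_le hA.2 with rfl | hkc
  · left
    rw [e, matchWeight_outer hac hk hka]
    by_cases h : k = a + 1
    · subst h
      rw [matchWeight_empty (by omega)]
      exact (congrArg _ (hnil (a + 1) (by omega))).le
    · refine add_le_add le_rfl
        ((hW (a + 1) (k - 1) (by omega) (by omega) ⟨u - 1, by omega⟩).2 f fun m hm => ?_)
      simp only [Finset.mem_Icc] at hm
      obtain ⟨hM, hM', hM''⟩ := hf m (by simp; omega)
      simp only [Finset.mem_Icc] at hM ⊢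
      have h1 : f m ≠ a := by intro he; rw [he] at hM'; omega
      have h2 : f m ≠ k := by intro he; rw [he] at hM'; omega
      exact ⟨by omega, hM', hM''⟩
  · right
    have hle : ∀ m, a ≤ m → m ≤ k → f m ≤ k := by
      intro m h1 h2
      by_contra! h3
      rcases eq_or_lt_of_le h1 with rfl | h1
      · omega
      rcases eq_or_lt_of_le h2 with rfl | h2
      · omega
      obtain ⟨f', hf', hlt⟩ := hf.exists_lt_of_crossing hx hconc (m := m) h1
        (by omega) (by omega) (by omega)
      have := hmin f' hf'
      linarith
    have hL : IsPM a k f := by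
      intro m hm
      simp only [Finset.mem_Icc] at hm
      obtain ⟨hM, hM'⟩ := hf m (by simp; omega)
      have := hle m hm.1 hm.2
      simp only [Finset.mem_Icc] at hM ⊢
      exact ⟨by omega, hM'⟩
    have hR : IsPM (k + 1) c f := by
      intro m hm
      simp only [Finset.mem_Icc] at hm
      obtain ⟨hM, hM', hM''⟩ := hf m (by simp; omega)
      simp only [Finset.mem_Icc] at hM ⊢
      have : k < f m := by
        by_contra! h
        have := hle (f m) hM.1 h
        omega
      exact ⟨by omega, hM', hM''⟩
    have hLo := hL.odd_sub hA.1
    have hRo := hR.odd_sub hkc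
    refine ⟨k, by omega, hkc, hLo, ?_⟩
    have hne : k + 1 ≠ c := by rintro rfl; simp at hRo
    rw [e, matchWeight_split hA.1 hkc]
    exact add_le_add ((hW a k ha (by omega) hLo).2 f hL)
      ((hW (k + 1) c (by omega) (by omega) hRo).2 f hR)

theorem crossing_le (hx : StrictMono x)
    (hconc : ∀ a : ℝ, 0 ≤ a → ∀ b : ℝ, 0 ≤ b → a ≠ b → ∀ l : ℝ, 0 < l → l < 1 →
      l * g a + (1 - l) * g b < g (l * a + (1 - l) * b))
    {a b c d : ℕ} (hab : a < b) (hbc : b < c) (hcd : c < d) :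
    g |x a - x d| + g |x b - x c| ≤ g |x a - x c| + g |x b - x d| := by
  have l1 := hx hab
  have l2 := hx hbc
  have l3 := hx hcd
  have h := crossing_lt hconc (sub_pos.mpr l1) (sub_pos.mpr l2).le (sub_pos.mpr l3)
  rw [abs_sub_comm (x a), abs_sub_comm (x b), abs_sub_comm (x a), abs_sub_comm (x b),
    abs_of_pos (show 0 < x d - x a by linarith), abs_of_pos (show 0 < x c - x b by linarith),
    abs_of_pos (show 0 < x c - x a by linarith), abs_of_pos (show 0 < x d - x b by linarith)]
  rw [show x b - x a + (x c - x b) + (x d - x c) = x d - x a by ring,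
    show x b - x a + (x c - x b) = x c - x a by ring,
    show x c - x b + (x d - x c) = x d - x b by ring] at h
  exact h.le

/-- The minimum weights satisfy the reverse quadrangle inequality. -/
theorem minWeight_quadrangle (hx : StrictMono x)
    (hconc : ∀ a : ℝ, 0 ≤ a → ∀ b : ℝ, 0 ≤ b → a ≠ b → ∀ l : ℝ, 0 < l → l < 1 →
      l * g a + (1 - l) * g b < g (l * a + (1 - l) * b))
    (hW : ∀ i j : ℕ, 1 ≤ i → i < j → Odd (j - i) → IsMinWeight x g i j (W i j))
    (hnil : ∀ i : ℕ, 1 ≤ i → W i (i - 1) = 0) :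
    ∀ N a b c d : ℕ, d - a + (c - b) ≤ N → 1 ≤ a → a ≤ b → b ≤ c + 1 → c ≤ d → Even (b - a) →
      Even (c + 1 - b) → Even (d - c) → W a d + W b c ≤ W a c + W b d := by
  intro N
  induction N using Nat.strong_induction_on with
  | _ N ih =>
  intro a b c d hN ha hab hbc hcd pab pbc pcd
  have ih' : ∀ a' b' c' d' : ℕ, d' - a' + (c' - b') < d - a + (c - b) → 1 ≤ a' → a' ≤ b' →
      b' ≤ c' + 1 → c' ≤ d' → Even (b' - a') → Even (c' + 1 - b') → Even (d' - c') →
      W a' d' + W b' c' ≤ W a' c' + W b' d' :=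
    fun a' b' c' d' h => ih _ (h.trans_le hN) a' b' c' d' le_rfl
  rcases eq_or_lt_of_le hab with rfl | hab
  · rw [add_comm]
  rcases eq_or_lt_of_le hcd with rfl | hcd
  · exact le_rfl
  have hadd := @minWeight_le_add x g W hW hnil
  obtain ⟨u, hu⟩ := pab
  obtain ⟨v, hv⟩ := pbc
  obtain ⟨w, hw⟩ := pcd
  rcases eq_or_lt_of_le hbc with rfl | hbc
  · have h0 := hnil (c + 1) (by omega)
    simp only [Nat.add_sub_cancel] at h0
    rw [h0, add_zero]
    exact hadd ha (by omega) hcd.le ⟨u, by omega⟩ ⟨w, by omega⟩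
  have hbc' : b < c := by omega
  rcases minWeight_outer_or_split hx hconc hW hnil ha (show a < c by omega)
    ⟨u + v - 1, by omega⟩ with h₁ | ⟨k, hak, hkc, ⟨t, ht⟩, h₁⟩
  swap
  · rcases lt_or_ge k b with hkb | hkb
    · have h₂ := ih' (k + 1) b c d (by omega) (by omega) (by omega) (by omega) hcd.le
        ⟨u - t - 1, by omega⟩ ⟨v, hv⟩ ⟨w, hw⟩
      have h₃ := hadd (k := k) (c := d) ha (by omega) (by omega) ⟨t + 1, by omega⟩
        ⟨u + v + w - t - 1, by omega⟩
      linarith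
    · have h₂ := ih' a b k d (by omega) ha hab.le (by omega) (by omega)
        ⟨u, hu⟩ ⟨t + 1 - u, by omega⟩ ⟨u + v + w - t - 1, by omega⟩
      have h₃ := hadd (a := b) (k := k) (c := c) (by omega) (by omega) (by omega)
        ⟨t + 1 - u, by omega⟩ ⟨u + v - t - 1, by omega⟩
      linarith
  rcases minWeight_outer_or_split hx hconc hW hnil (show 1 ≤ b by omega) (show b < d by omega)
    ⟨v + w - 1, by omega⟩ with h₂ | ⟨l, hbl, hld, ⟨t, ht⟩, h₂⟩
  swap
  · rcases lt_or_ge l c with hlc | hlc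
    · have h₃ := ih' a (l + 1) c d (by omega) ha (by omega) (by omega) hcd.le
        ⟨u + t + 1, by omega⟩ ⟨v - t - 1, by omega⟩ ⟨w, hw⟩
      have h₄ := hadd (a := b) (k := l) (c := c) (by omega) (by omega) (by omega)
        ⟨t + 1, by omega⟩ ⟨v - t - 1, by omega⟩
      linarith
    · have h₃ := ih' a b c l (by omega) ha (by omega) (by omega) hlc
        ⟨u, by omega⟩ ⟨v, by omega⟩ ⟨t + 1 - v, by omega⟩
      have h₄ := hadd (a := a) (k := l) (c := d) (by omega) (by omega) (by omega)
        ⟨u + t + 1, by omega⟩ ⟨v + w - t - 1, by omega⟩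
      linarith
  have h₃ := ih' (a + 1) (b + 1) (c - 1) (d - 1) (by omega) (by omega) (by omega) (by omega)
    (by omega) ⟨u, by omega⟩ ⟨v - 1, by omega⟩ ⟨w, by omega⟩
  have h₄ := minWeight_le_outer hW hnil ha (show a < d by omega) ⟨u + v + w - 1, by omega⟩
  have h₅ := minWeight_le_outer hW hnil (show 1 ≤ b by omega) hbc' ⟨v - 1, by omega⟩
  have h₆ := crossing_le hx hconc hab hbc' hcd
  linarith

end MinWeight

/-- The bottom-up recursion
`W(i,j) = min (d(xᵢ,xⱼ) + W(i+1,j-1)) (W(i,j-2) + W(i+2,j) - W(i+2,j-2))`,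
with the conventions `W(i,i-1) = 0` and `W(i+2,i-1) = -d(xᵢ,x_{i+1})`. -/
theorem stmt_15 (x : ℕ → ℝ) (hx : StrictMono x) (g : ℝ → ℝ)
    (hconc : ∀ a : ℝ, 0 ≤ a → ∀ b : ℝ, 0 ≤ b → a ≠ b → ∀ l : ℝ, 0 < l → l < 1 →
      l * g a + (1 - l) * g b < g (l * a + (1 - l) * b))
    (h0 : g 0 = 0) (hpos : ∀ a : ℝ, 0 < a → 0 < g a)
    (W : ℕ → ℕ → ℝ)
    (hW : ∀ i j : ℕ, 1 ≤ i → i < j → Odd (j - i) → IsMinWeight x g i j (W i j))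
    (hconv1 : ∀ i : ℕ, 1 ≤ i → W i (i - 1) = 0)
    (hconv2 : ∀ i : ℕ, 1 ≤ i → W (i + 2) (i - 1) = -g |x i - x (i + 1)|) :
    ∀ i j : ℕ, 1 ≤ i → i < j → Odd (j - i) →
      W i j = min (g |x i - x j| + W (i + 1) (j - 1))
        (W i (j - 2) + W (i + 2) j - W (i + 2) (j - 2)) := by
  intro i j hi hij hodd
  have hout := minWeight_le_outer hW hconv1 hi hij hodd
  have hdec := minWeight_outer_or_split hx hconc hW hconv1 hi hij hodd
  have hquad := fun a b c d => minWeight_quadrangle hx hconc hW hconv1 _ a b c d le_rfl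
  obtain ⟨u, hu⟩ := hodd
  rcases Nat.eq_zero_or_pos u with rfl | hu0
  · obtain rfl : j = i + 1 := by omega
    have e1 := hconv1 i hi
    have e2 := hconv1 (i + 1) (by omega)
    have e3 := hconv1 (i + 2) (by omega)
    have e4 := hconv2 i hi
    simp only [Nat.add_sub_cancel, show i + 2 - 1 = i + 1 by omega] at e2 e3
    rw [show i + 1 - 2 = i - 1 by omega, Nat.add_sub_cancel, e1, e2, e3, e4]
    rw [Nat.add_sub_cancel, e2] at hout hdec
    rw [show g |x i - x (i + 1)| + 0 = g |x i - x (i + 1)| by ring,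
      show 0 + 0 - -g |x i - x (i + 1)| = g |x i - x (i + 1)| by ring, min_self]
    rcases hdec with h | ⟨k, h1, h2, -⟩
    · linarith
    · omega
  apply le_antisymm
  · refine le_min hout ?_
    have := hquad i (i + 2) (j - 2) j hi (by omega) (by omega) (by omega) ⟨1, by omega⟩
      ⟨u - 1, by omega⟩ ⟨1, by omega⟩
    linarith
  · rcases hdec with h | ⟨k, hik, hkj, ⟨t, ht⟩, h⟩
    · exact (min_le_left _ _).trans h
    · refine (min_le_right _ _).trans ?_
      have h₁ := hquad i (i + 2) k (j - 2) hi (by omega) (by omega) (by omega) ⟨1, by omega⟩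
        ⟨t, by omega⟩ ⟨u - 1 - t, by omega⟩
      have h₂ := minWeight_le_add hW hconv1 (a := i + 2) (k := k) (c := j) (by omega) (by omega)
        (by omega) ⟨t, by omega⟩ ⟨u - t, by omega⟩
      linarith
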